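/- Let N ≥ 3, λ > 0, μ ≤ 0 and 2 < p < 2*. If u is a classical solution of problem (1.1) lying in X (finite weighted energy), then u ≡ 0 on ℝ^N_+. -/

import Mathlib

open MeasureTheory Real Topology Filter

noncomputable section

/-- `ℝ^N` as Euclidean space. -/
abbrev Euc (N : ℕ) := EuclideanSpace ℝ (Fin N)

/-- Gaussian-type weight `K(x) = exp(|x|²/4)`. -/
noncomputable def Kw {N : ℕ} (x : Euc N) : ℝ := Real.exp (‖x‖ ^ 2 / 4)

/-- critical Sobolev exponent `2* = 2N/(N-2)` -/
noncomputable def twoStar (N : ℕ) : ℝ := 2 * (N : ℝ) / ((N : ℝ) - 2)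

/-- critical trace exponent `2_* = 2(N-1)/(N-2)` -/
noncomputable def twoStarL (N : ℕ) : ℝ := 2 * ((N : ℝ) - 1) / ((N : ℝ) - 2)

/-- `i`-th partial derivative of `u` at `x` -/
noncomputable def pd {N : ℕ} (u : Euc N → ℝ) (i : Fin N) (x : Euc N) : ℝ :=
  fderiv ℝ u x (EuclideanSpace.single i 1)

/-- `|∇u(x)|²` -/
noncomputable def gradSq {N : ℕ} (u : Euc N → ℝ) (x : Euc N) : ℝ :=
  ∑ i, (pd u i x) ^ 2

/-- `x · ∇u(x)` -/
noncomputable def radial {N : ℕ} (u : Euc N → ℝ) (x : Euc N) : ℝ :=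
  ∑ i, x i * pd u i x

/-- Laplacian `Δu(x)` -/
noncomputable def lap {N : ℕ} (u : Euc N → ℝ) (x : Euc N) : ℝ :=
  ∑ i, pd (pd u i) i x

/-- index of the vertical coordinate `x_N` -/
def lastIdx (N : ℕ) (h : 0 < N) : Fin N := ⟨N - 1, by omega⟩

/-- open upper half-space `ℝ^N_+` -/
def upperHS (N : ℕ) (h : 0 < N) : Set (Euc N) := {x | 0 < x (lastIdx N h)}

/-- closed upper half-space -/
def upperHSc (N : ℕ) (h : 0 < N) : Set (Euc N) := {x | 0 ≤ x (lastIdx N h)}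

/-- boundary hyperplane `∂ℝ^N_+` -/
def bdryHS (N : ℕ) (h : 0 < N) : Set (Euc N) := {x | x (lastIdx N h) = 0}

/-- vertical derivative `∂u/∂x_N`, taken within the closed half-space -/
noncomputable def pdN (N : ℕ) (h : 0 < N) (u : Euc N → ℝ) (x : Euc N) : ℝ :=
  fderivWithin ℝ u (upperHSc N h) x (EuclideanSpace.single (lastIdx N h) 1)

/-- embedding of `ℝ^{N-1}` as the boundary of the half-space, `y ↦ (y, 0)` -/
noncomputable def emb (N : ℕ) (y : Euc (N - 1)) : Euc N :=
  (EuclideanSpace.equiv (Fin N) ℝ).symm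
    (fun i => if hi : (i : ℕ) < N - 1 then y ⟨(i : ℕ), hi⟩ else 0)

/-- finite weighted energy, i.e. membership in the space `X` -/
def FiniteEnergy (N : ℕ) (h : 0 < N) (u : Euc N → ℝ) : Prop :=
  IntegrableOn (fun x => Kw x * (gradSq u x + (u x) ^ 2)) (upperHS N h)

/-- classical solution of problem (1.1) -/
structure IsClassicalSolution (N : ℕ) (h : 0 < N) (lam mu p : ℝ) (u : Euc N → ℝ) : Prop where
  smooth2 : ContDiffOn ℝ 2 u (upperHS N h)
  smooth1 : ContDiffOn ℝ 1 u (upperHSc N h)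
  pde : ∀ x ∈ upperHS N h,
    -lap u x - (1 / 2) * radial u x
      = lam * |u x| ^ (twoStar N - 2) * u x + mu * |u x| ^ (p - 2) * u x
  bc : ∀ x ∈ bdryHS N h,
    -pdN N h u x = Real.sqrt lam * |u x| ^ (twoStarL N - 2) * u x

/-- `x_N⁰ = √(N/(N-2))` -/
noncomputable def xN0 (N : ℕ) : ℝ := Real.sqrt ((N : ℝ) / ((N : ℝ) - 2))

/-- `k_N = (N(N-2))^{(N-2)/4}` -/
noncomputable def kN (N : ℕ) : ℝ := ((N : ℝ) * ((N : ℝ) - 2)) ^ (((N : ℝ) - 2) / 4)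

/-- `|x'|²`, squared norm of the horizontal part -/
noncomputable def horizSq {N : ℕ} (h : 0 < N) (x : Euc N) : ℝ :=
  ∑ i ∈ Finset.univ.erase (lastIdx N h), (x i) ^ 2

/-- the family `φ_{ε,τ}` -/
noncomputable def bubbleT (N : ℕ) (h : 0 < N) (ε τ : ℝ) (x : Euc N) : ℝ :=
  (ε * Real.sqrt ((N : ℝ) * ((N : ℝ) - 2)) /
      (ε ^ 2 + horizSq h x + (x (lastIdx N h) + ε * τ * xN0 N) ^ 2)) ^ (((N : ℝ) - 2) / 2)

/-- the boundary bubble `U_ε = φ_{ε,1}` -/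
noncomputable def Ubub (N : ℕ) (h : 0 < N) (ε : ℝ) (x : Euc N) : ℝ := bubbleT N h ε 1 x

/-- `K₁ = ∫_{ℝ^N_+} |∇U_ε|²` (an `ε`-independent constant, computed at `ε = 1`) -/
noncomputable def Kone (N : ℕ) (h : 0 < N) : ℝ :=
  ∫ x in upperHS N h, gradSq (Ubub N h 1) x

/-- `K₂ = ∫_{ℝ^N_+} U_ε^{2*}` -/
noncomputable def Ktwo (N : ℕ) (h : 0 < N) : ℝ :=
  ∫ x in upperHS N h, (Ubub N h 1 x) ^ twoStar N

/-- `K₃ = ∫_{ℝ^{N-1}} U_ε(x',0)^{2_*}` -/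
noncomputable def Kthree (N : ℕ) (h : 0 < N) : ℝ :=
  ∫ y : Euc (N - 1), (Ubub N h 1 (emb N y)) ^ twoStarL N

/-- cut-off function: `φ ∈ C_c^∞(ℝ^N,[0,1])`, `φ ≡ 1` on `B₁(0)`, `φ ≡ 0` outside `B₂(0)` -/
structure IsCutoff (N : ℕ) (φ : Euc N → ℝ) : Prop where
  smooth : ContDiff ℝ (⊤ : ℕ∞) φ
  mem01 : ∀ x, φ x ∈ Set.Icc (0 : ℝ) 1
  eq_one : ∀ x ∈ Metric.closedBall (0 : Euc N) 1, φ x = 1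
  eq_zero : ∀ x ∉ Metric.ball (0 : Euc N) 2, φ x = 0

/-- truncated weighted bubble `Ũ_ε = K^{-1/2} φ U_ε` -/
noncomputable def Ut (N : ℕ) (h : 0 < N) (φ : Euc N → ℝ) (ε : ℝ) (x : Euc N) : ℝ :=
  (Kw x) ^ (-(1 : ℝ) / 2) * φ x * Ubub N h ε x

/-- smooth compactly supported test functions on the closed half-space -/
structure IsTestFun (N : ℕ) (h : 0 < N) (u : Euc N → ℝ) : Prop where
  smooth : ContDiff ℝ (⊤ : ℕ∞) u
  cpt : HasCompactSupport u
  supp : tsupport u ⊆ upperHSc N h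

/-- the norm of the space `X`: `‖u‖ = (∫ K |∇u|²)^{1/2}` -/
noncomputable def Xnorm (N : ℕ) (h : 0 < N) (u : Euc N → ℝ) : ℝ :=
  Real.sqrt (∫ x in upperHS N h, Kw x * gradSq u x)


/-! ### A box divergence theorem -/

lemma box_div (n : ℕ) (a b : Fin (n+1) → ℝ) (hle : a ≤ b)
    (V : Fin (n+1) → (Fin (n+1) → ℝ) → ℝ) (D : (Fin (n+1) → ℝ) → ℝ)
    (hc : ∀ i, ContinuousOn (V i) (Set.Icc a b)) (hD : ContinuousOn D (Set.Icc a b))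
    (hd : ∀ y, (∀ i, a i < y i ∧ y i < b i) →
      ∃ V' : Fin (n+1) → ((Fin (n+1) → ℝ) →L[ℝ] ℝ), (∀ i, HasFDerivAt (V i) (V' i) y) ∧
        ∑ i, V' i (Pi.single i 1) = D y) :
    ∫ y in Set.Icc a b, D y =
      ∑ i : Fin (n + 1), ((∫ x in Set.Icc (a ∘ Fin.succAbove i) (b ∘ Fin.succAbove i),
          V i (Fin.insertNth i (b i) x)) -
        ∫ x in Set.Icc (a ∘ Fin.succAbove i) (b ∘ Fin.succAbove i),
          V i (Fin.insertNth i (a i) x)) := by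
  have hae : (Set.pi Set.univ fun i => Set.Ioo (a i) (b i)) =ᵐ[volume] Set.Icc a b :=
    Measure.univ_pi_Ioo_ae_eq_Icc
  have hmeas : MeasurableSet (Set.pi Set.univ fun i => Set.Ioo (a i) (b i)) :=
    MeasurableSet.univ_pi fun i => measurableSet_Ioo
  have heq : ∀ y ∈ (Set.pi Set.univ fun i => Set.Ioo (a i) (b i)),
      D y = ∑ i, fderiv ℝ (V i) y (Pi.single i 1) := by
    intro y hy
    obtain ⟨V', h1, h2⟩ := hd y (fun i => hy i (Set.mem_univ i))
    rw [← h2]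
    exact Finset.sum_congr rfl fun i _ => by rw [(h1 i).fderiv]
  have hDi : IntegrableOn D (Set.Icc a b) := hD.integrableOn_compact isCompact_Icc
  rw [← setIntegral_congr_set hae, setIntegral_congr_fun hmeas heq, setIntegral_congr_set hae]
  refine integral_divergence_of_hasFDerivAt_off_countable' a b hle V
    (fun i y => fderiv ℝ (V i) y) ∅ Set.countable_empty hc ?_ ?_
  · intro x hx i
    obtain ⟨V', h1, h2⟩ := hd x (fun i => hx.1 i (Set.mem_univ i))
    rw [(h1 i).fderiv]; exact h1 i
  · rw [← integrableOn_congr_set_ae hae]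
    refine IntegrableOn.congr_fun ?_ heq hmeas
    rw [integrableOn_congr_set_ae hae]
    exact hDi

/-! ### The cut-off -/

lemma hasDerivAt_posSq (t : ℝ) : HasDerivAt (fun t : ℝ => (max 0 t) ^ 2) (2 * max 0 t) t := by
  rcases lt_trichotomy t 0 with h | h | h
  · rw [max_eq_left h.le, mul_zero]
    refine (hasDerivAt_const t (0:ℝ)).congr_of_eventuallyEq ?_
    filter_upwards [Iio_mem_nhds h] with s hs
    rw [max_eq_left (le_of_lt hs)]; norm_num
  · subst h
    rw [max_self, mul_zero]
    have : HasFDerivAt (fun t : ℝ => (max 0 t) ^ 2) (0 : ℝ →L[ℝ] ℝ) 0 := by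
      refine Asymptotics.IsBigO.hasFDerivAt (n := 2) ?_ (by norm_num)
      refine Asymptotics.IsBigO.of_bound 1 (Eventually.of_forall fun s => ?_)
      rcases le_total s 0 with h | h
      · rw [max_eq_left h]; simp; positivity
      · rw [max_eq_right h]; simp
    simpa using this.hasDerivAt
  · rw [max_eq_right h.le]
    have := (hasDerivAt_pow 2 t)
    refine (this.congr_of_eventuallyEq ?_).congr_deriv (by norm_num)
    filter_upwards [Ioi_mem_nhds h] with s hs
    rw [max_eq_right (le_of_lt hs)]

/-- cut-off as a function of `s = |x|²` -/
def ct (R s : ℝ) : ℝ := (max 0 (1 - s / R ^ 2)) ^ 2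

/-- `∂_i (ct R |x|²) = ctd R |x|² * x_i` -/
def ctd (R s : ℝ) : ℝ := - (4 / R ^ 2) * max 0 (1 - s / R ^ 2)

lemma hasDerivAt_ct (R s : ℝ) : HasDerivAt (ct R) (ctd R s / 2) s := by
  have h1 : HasDerivAt (fun s : ℝ => 1 - s / R ^ 2) (-(1 / R ^ 2)) s := by
    simpa using ((hasDerivAt_id s).div_const (R^2)).const_sub 1
  refine ((hasDerivAt_posSq (1 - s / R^2)).comp s h1).congr_deriv ?_
  unfold ctd; ring

lemma continuous_ct (R : ℝ) : Continuous (ct R) := by unfold ct; fun_prop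
lemma continuous_ctd (R : ℝ) : Continuous (ctd R) := by unfold ctd; fun_prop

lemma ct_nonneg (R s : ℝ) : 0 ≤ ct R s := by unfold ct; positivity
lemma ctd_nonpos (R s : ℝ) : ctd R s ≤ 0 := by
  unfold ctd
  have : 0 ≤ (4 / R ^ 2) * max 0 (1 - s / R ^ 2) := by positivity
  linarith
lemma neg_ctd_le (R s : ℝ) (hs : 0 ≤ s) : - ctd R s ≤ 4 / R ^ 2 := by
  unfold ctd
  have h0 : 0 ≤ s / R ^ 2 := by positivity
  have h1 : max 0 (1 - s / R ^ 2) ≤ 1 := max_le (by norm_num) (by linarith)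
  have h2 : 0 ≤ 4 / R ^ 2 := by positivity
  nlinarith
lemma ct_eq_zero (R s : ℝ) (hR : 0 < R) (hs : R ^ 2 ≤ s) : ct R s = 0 := by
  unfold ct
  rw [max_eq_left]; · norm_num
  have : 1 ≤ s / R ^ 2 := by rw [le_div_iff₀ (by positivity)]; linarith
  linarith
lemma ct_ge (R s : ℝ) (hR : 0 < R) (hs : 2 * s ≤ R ^ 2) : 1 / 4 ≤ ct R s := by
  unfold ct
  have : s / R ^ 2 ≤ 1 / 2 := by rw [div_le_iff₀ (by positivity)]; linarith
  have h2 : 1/2 ≤ max 0 (1 - s / R ^ 2) := le_max_of_le_right (by linarith)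
  nlinarith

/-! ### Scalar inequality and algebra -/

lemma young_lower (lam mu p q : ℝ) (hlam : 0 < lam) (hmu : mu ≤ 0) (hp1 : 2 < p) (hpq : p < q) :
    ∃ C : ℝ, 0 ≤ C ∧ ∀ t : ℝ, - C * t ^ 2 ≤ lam / q * |t| ^ q + mu / p * |t| ^ p := by
  have hq : 0 < q := by linarith
  have htend : Tendsto (fun T : ℝ => (-mu / p) * T ^ (-(q - p))) atTop (𝓝 ((-mu / p) * 0)) :=
    (tendsto_rpow_neg_atTop (by linarith)).const_mul _
  rw [mul_zero] at htend
  have hpos : 0 < lam / q := by positivity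
  obtain ⟨T, hT, hT1⟩ := ((htend.eventually (gt_mem_nhds hpos)).and (eventually_gt_atTop 0)).exists
  have hmp : 0 ≤ -mu / p := div_nonneg (by linarith) (by linarith)
  refine ⟨(-mu / p) * T ^ (p - 2), by positivity, fun t => ?_⟩
  have hs : 0 ≤ |t| := abs_nonneg t
  rw [← sq_abs t]
  generalize |t| = s at hs
  have key : s ^ p ≤ T ^ (p - 2) * s ^ 2 + T ^ (-(q - p)) * s ^ q := by
    rcases hs.eq_or_lt with rfl | hs'
    · rw [Real.zero_rpow (by linarith), Real.zero_rpow (by linarith)]; simp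
    rcases le_total s T with h | h
    · have e : s ^ p = s ^ (p - 2) * s ^ 2 := by
        rw [← Real.rpow_natCast s 2, ← Real.rpow_add hs']; norm_num
      rw [e]
      have := Real.rpow_le_rpow hs h (by linarith : 0 ≤ p - 2)
      have h3 : 0 ≤ T ^ (-(q - p)) * s ^ q := by positivity
      have := mul_le_mul_of_nonneg_right this (sq_nonneg s)
      linarith
    · have e : s ^ p = s ^ (-(q - p)) * s ^ q := by
        rw [← Real.rpow_add hs']; congr 1; ring
      rw [e]
      have := Real.rpow_le_rpow_of_nonpos hT1 h (by linarith : -(q-p) ≤ 0)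
      have h3 : 0 ≤ T ^ (p - 2) * s ^ 2 := by positivity
      have := mul_le_mul_of_nonneg_right this (by positivity : 0 ≤ s ^ q)
      linarith
  have h1 := mul_le_mul_of_nonneg_left key hmp
  have h2 := mul_le_mul_of_nonneg_right hT.le (by positivity : 0 ≤ s ^ q)
  have e : mu / p * s ^ p = - ((-mu / p) * s ^ p) := by ring
  rw [e]
  nlinarith

lemma div_alg {N : ℕ} (x g : Fin N → ℝ) (H : Fin N → Fin N → ℝ) (hs : ∀ i j, H i j = H j i)
    (u Gu gu a η k l : ℝ) :
    ∑ i, (a * x i * ((∑ j, x j * g j) * g i - 1/2 * (∑ j, g j ^ 2) * x i + k * (u * g i) + Gu * x i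
          - l * u ^ 2 * x i)
       + η * ((g i + ∑ j, x j * H j i) * g i + (∑ j, x j * g j) * H i i
          - (∑ j, g j * H j i) * x i - 1/2 * (∑ j, g j ^ 2)
          + k * (g i * g i + u * H i i) + (gu * g i * x i + Gu) - l * (2 * u * g i * x i + u ^ 2)))
    = a * ((∑ j, x j * g j) ^ 2 - 1/2 * (∑ j, g j ^ 2) * (∑ j, x j ^ 2)
          + k * u * (∑ j, x j * g j) + Gu * (∑ j, x j ^ 2) - l * u ^ 2 * (∑ j, x j ^ 2))
      + η * ((1 + k - N / 2) * (∑ j, g j ^ 2) + ((∑ j, x j * g j) + k * u) * (∑ j, H j j)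
          + gu * (∑ j, x j * g j) + N * Gu - l * (2 * u * (∑ j, x j * g j) + N * u ^ 2)) := by
  have hsym : ∑ i, (∑ j, x j * H j i) * g i = ∑ i, (∑ j, g j * H j i) * x i := by
    simp_rw [Finset.sum_mul]
    rw [Finset.sum_comm]
    refine Finset.sum_congr rfl fun i _ => Finset.sum_congr rfl fun j _ => ?_
    rw [hs i j]; ring
  set ρ := ∑ j, x j * g j with hρ
  set Q := ∑ j, g j ^ 2 with hQ
  set X := ∑ j, x j ^ 2 with hX
  set L := ∑ j, H j j with hL
  have e : ∀ i, (a * x i * (ρ * g i - 1/2 * Q * x i + k * (u * g i) + Gu * x i - l * u ^ 2 * x i)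
       + η * ((g i + ∑ j, x j * H j i) * g i + ρ * H i i
          - (∑ j, g j * H j i) * x i - 1/2 * Q
          + k * (g i * g i + u * H i i) + (gu * g i * x i + Gu) - l * (2 * u * g i * x i + u ^ 2)))
      = (a * (ρ + k * u) + η * (gu - 2 * l * u)) * (x i * g i)
        + (a * (Gu - 1/2 * Q - l * u^2)) * (x i ^ 2) + η * (1 + k) * g i ^ 2
        + η * (ρ + k * u) * H i i + η * ((∑ j, x j * H j i) * g i)
        - η * ((∑ j, g j * H j i) * x i) + η * (Gu - 1/2 * Q - l * u^2) := fun i => by ring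
  rw [Finset.sum_congr rfl fun i _ => e i]
  simp only [Finset.sum_add_distrib, Finset.sum_sub_distrib, ← Finset.mul_sum, ← hρ, ← hQ, ← hX,
    ← hL, hsym]
  simp only [Finset.sum_const, Finset.card_univ, Fintype.card_fin, nsmul_eq_mul]
  ring

/-! ### The Pohozaev vector field -/

/-- the cut-off Pohozaev field -/
def Fld {N : ℕ} (g : Fin N → Euc N → ℝ) (u : Euc N → ℝ) (G : ℝ → ℝ) (R k l : ℝ) (i : Fin N)
    (x : Euc N) : ℝ :=
  ct R (∑ j, x j ^ 2) * ((∑ j, x j * g j x) * g i x - 1/2 * (∑ j, g j x ^ 2) * x i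
    + k * (u x * g i x) + G (u x) * x i - l * u x ^ 2 * x i)

lemma hasFDerivAt_coord {N : ℕ} (j : Fin N) (x : Euc N) :
    HasFDerivAt (fun x : Euc N => x j) (EuclideanSpace.proj j : Euc N →L[ℝ] ℝ) x :=
  (EuclideanSpace.proj j : Euc N →L[ℝ] ℝ).hasFDerivAt

lemma sum_coord_single {N : ℕ} (i : Fin N) (c : Fin N → ℝ) :
    ∑ j, c j * (EuclideanSpace.single i (1:ℝ) : Euc N) j = c i := by
  simp

lemma hasFDerivAt_ct {N : ℕ} (R : ℝ) (x : Euc N) :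
    ∃ c' : Euc N →L[ℝ] ℝ, HasFDerivAt (fun x : Euc N => ct R (∑ j, x j ^ 2)) c' x ∧
      ∀ i, c' (EuclideanSpace.single i 1) = ctd R (∑ j, x j ^ 2) * x i := by
  have h1 : HasFDerivAt (fun x : Euc N => ∑ j, x j ^ 2) _ x :=
    HasFDerivAt.fun_sum (u := Finset.univ) fun j _ => (hasFDerivAt_coord j x).pow 2
  refine ⟨_, (hasDerivAt_ct R _).comp_hasFDerivAt x h1, fun i => ?_⟩
  simp [sum_apply]
  ring

lemma Fld_deriv {N : ℕ} (g : Fin N → Euc N → ℝ) (u : Euc N → ℝ) (G : ℝ → ℝ) (R k l : ℝ)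
    (x : Euc N) (g' : Fin N → Euc N →L[ℝ] ℝ) (u' : Euc N →L[ℝ] ℝ) (gu : ℝ)
    (hg : ∀ i, HasFDerivAt (g i) (g' i) x) (hu : HasFDerivAt u u' x)
    (hG : HasDerivAt G gu (u x)) (hui : ∀ i, u' (EuclideanSpace.single i 1) = g i x) (i : Fin N) :
    ∃ V' : Euc N →L[ℝ] ℝ, HasFDerivAt (Fld g u G R k l i) V' x ∧
      V' (EuclideanSpace.single i 1) =
        ctd R (∑ j, x j ^ 2) * x i * ((∑ j, x j * g j x) * g i x - 1/2 * (∑ j, g j x ^ 2) * x i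
          + k * (u x * g i x) + G (u x) * x i - l * u x ^ 2 * x i)
        + ct R (∑ j, x j ^ 2) *
          ((g i x + ∑ j, x j * g' j (EuclideanSpace.single i 1)) * g i x
          + (∑ j, x j * g j x) * g' i (EuclideanSpace.single i 1)
          - (∑ j, g j x * g' j (EuclideanSpace.single i 1)) * x i - 1/2 * (∑ j, g j x ^ 2)
          + k * (g i x * g i x + u x * g' i (EuclideanSpace.single i 1))
          + (gu * g i x * x i + G (u x)) - l * (2 * u x * g i x * x i + u x ^ 2)) := by
  obtain ⟨c', hc, hc'⟩ := hasFDerivAt_ct R x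
  have hρ : HasFDerivAt (fun x : Euc N => ∑ j, x j * g j x) _ x :=
    HasFDerivAt.fun_sum (u := Finset.univ) fun j _ => (hasFDerivAt_coord j x).mul (hg j)
  have hQ : HasFDerivAt (fun x : Euc N => ∑ j, g j x ^ 2) _ x :=
    HasFDerivAt.fun_sum (u := Finset.univ) fun j _ => (hg j).pow 2
  have hxi := hasFDerivAt_coord i x
  have hGu : HasFDerivAt (fun x => G (u x)) (gu • u') x := hG.comp_hasFDerivAt x hu
  refine ⟨_, hc.mul (((((hρ.mul (hg i)).sub ((hQ.const_mul (1/2)).mul hxi)).add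
    ((hu.mul (hg i)).const_mul k)).add (hGu.mul hxi)).sub (((hu.pow 2).const_mul l).mul hxi)), ?_⟩
  simp only [add_apply, sub_apply, smul_apply,
    sum_apply, hui, hc', smul_eq_mul,
    Finset.sum_add_distrib]
  have e1 : ∑ j, g j x * (EuclideanSpace.single i (1:ℝ) : Euc N) j = g i x := sum_coord_single i _
  have e2 : ∑ j, (2 • g j x ^ (2-1)) • (g' j (EuclideanSpace.single i 1))
      = 2 * ∑ j, g j x * g' j (EuclideanSpace.single i 1) := by
    rw [Finset.mul_sum]; refine Finset.sum_congr rfl fun j _ => ?_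
    simp; ring
  simp only [smul_eq_mul] at e2
  simp at e2 ⊢
  simp only [e2]
  ring

/-! ### Regularity facts on the half space -/

/-- gradient components, continuous up to the boundary -/
def gc (N : ℕ) (h : 0 < N) (u : Euc N → ℝ) (i : Fin N) (x : Euc N) : ℝ :=
  fderivWithin ℝ u (upperHSc N h) x (EuclideanSpace.single i 1)

lemma continuous_coord {N : ℕ} (j : Fin N) : Continuous (fun x : Euc N => x j) :=
  (EuclideanSpace.proj j : Euc N →L[ℝ] ℝ).continuous

lemma isOpen_upperHS (N : ℕ) (h : 0 < N) : IsOpen (upperHS N h) :=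
  isOpen_lt continuous_const (continuous_coord _)

lemma upperHS_subset (N : ℕ) (h : 0 < N) : upperHS N h ⊆ upperHSc N h :=
  fun x hx => by
    simp only [upperHS, upperHSc, Set.mem_ofPred_eq] at *
    exact hx.le

lemma convex_upperHSc (N : ℕ) (h : 0 < N) : Convex ℝ (upperHSc N h) := by
  intro x hx y hy a b ha hb hab
  simp only [upperHSc, Set.mem_ofPred_eq, PiLp.add_apply, PiLp.smul_apply, smul_eq_mul] at *
  positivity

lemma uniqueDiffOn_upperHSc (N : ℕ) (h : 0 < N) : UniqueDiffOn ℝ (upperHSc N h) := by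
  refine uniqueDiffOn_convex (convex_upperHSc N h) ⟨EuclideanSpace.single (lastIdx N h) 1, ?_⟩
  refine interior_mono (upperHS_subset N h) ?_
  rw [(isOpen_upperHS N h).interior_eq]
  simp [upperHS]

lemma continuousOn_gc (N : ℕ) (h : 0 < N) (u : Euc N → ℝ) (hu : ContDiffOn ℝ 1 u (upperHSc N h))
    (i : Fin N) : ContinuousOn (gc N h u i) (upperHSc N h) := by
  have := hu.continuousOn_fderivWithin (uniqueDiffOn_upperHSc N h) (by norm_num)
  exact this.clm_apply continuousOn_const

lemma gc_eq (N : ℕ) (h : 0 < N) (u : Euc N → ℝ) (i : Fin N) (x : Euc N) (hx : x ∈ upperHS N h) :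
    gc N h u i x = pd u i x := by
  unfold gc pd
  rw [fderivWithin_of_mem_nhds]
  exact mem_of_superset ((isOpen_upperHS N h).mem_nhds hx) (upperHS_subset N h)

lemma hasFDerivAt_gc (N : ℕ) (h : 0 < N) (u : Euc N → ℝ) (hu : ContDiffOn ℝ 2 u (upperHS N h))
    (i : Fin N) (x : Euc N) (hx : x ∈ upperHS N h) :
    HasFDerivAt (gc N h u i) (fderiv ℝ (pd u i) x) x := by
  have hmem := (isOpen_upperHS N h).mem_nhds hx
  have h1 : ContDiffAt ℝ 2 u x := hu.contDiffAt hmem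
  have h2 : DifferentiableAt ℝ (fderiv ℝ u) x :=
    (h1.fderiv_right (m := 1) (by norm_num)).differentiableAt (by norm_num)
  have h3 : DifferentiableAt ℝ (pd u i) x := h2.clm_apply (differentiableAt_const _)
  refine h3.hasFDerivAt.congr_of_eventuallyEq ?_
  filter_upwards [hmem] with y hy using gc_eq N h u i y hy

lemma pd_symm (N : ℕ) (h : 0 < N) (u : Euc N → ℝ) (hu : ContDiffOn ℝ 2 u (upperHS N h))
    (i j : Fin N) (x : Euc N) (hx : x ∈ upperHS N h) :
    pd (pd u i) j x = pd (pd u j) i x := by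
  have hmem := (isOpen_upperHS N h).mem_nhds hx
  have h1 : ContDiffAt ℝ 2 u x := hu.contDiffAt hmem
  have h2 : DifferentiableAt ℝ (fderiv ℝ u) x :=
    (h1.fderiv_right (m := 1) (by norm_num)).differentiableAt (by norm_num)
  have key : ∀ i j : Fin N, pd (pd u i) j x
      = fderiv ℝ (fderiv ℝ u) x (EuclideanSpace.single j 1) (EuclideanSpace.single i 1) := by
    intro i j
    have : HasFDerivAt (pd u i) _ x :=
      h2.hasFDerivAt.clm_apply (hasFDerivAt_const (EuclideanSpace.single i (1:ℝ)) x)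
    unfold pd at this ⊢
    rw [this.fderiv]
    simp
  rw [key, key]
  exact (h1.isSymmSndFDerivAt (by simp)).eq _ _

/-- the divergence of the Pohozaev field, continuous up to the boundary -/
def Dv {N : ℕ} (g : Fin N → Euc N → ℝ) (u : Euc N → ℝ) (G : ℝ → ℝ) (R k l c p : ℝ)
    (x : Euc N) : ℝ :=
  ctd R (∑ j, x j ^ 2) * ((∑ j, x j * g j x) ^ 2 - 1/2 * (∑ j, g j x ^ 2) * (∑ j, x j ^ 2)
      + k * u x * (∑ j, x j * g j x) + G (u x) * (∑ j, x j ^ 2) - l * u x ^ 2 * (∑ j, x j ^ 2))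
    + ct R (∑ j, x j ^ 2) * (- 1/2 * ((∑ j, x j * g j x) + N / 2 * u x) ^ 2 - N / 4 * u x ^ 2
      - c * |u x| ^ p)

lemma abs_rpow_sub_two (t p : ℝ) (hp : 2 < p) : |t| ^ (p - 2) * t * t = |t| ^ p := by
  rcases eq_or_ne t 0 with rfl | ht
  · simp; rw [Real.zero_rpow (by linarith)]
  · have : 0 < |t| := abs_pos.2 ht
    have e : |t| ^ p = |t| ^ (p - 2) * |t| ^ 2 := by
      rw [← Real.rpow_natCast |t| 2, ← Real.rpow_add this]; norm_num
    rw [e, sq_abs]; ring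

lemma interior_div (N : ℕ) (hN : 3 ≤ N) (h : 0 < N) (lam mu p : ℝ)
    (hp1 : 2 < p) (u : Euc N → ℝ) (hu : IsClassicalSolution N h lam mu p u) (R : ℝ)
    (x : Euc N) (hx : x ∈ upperHS N h) :
    ∃ V' : Fin N → Euc N →L[ℝ] ℝ,
      (∀ i, HasFDerivAt (Fld (gc N h u) u
        (fun t => lam / twoStar N * |t| ^ twoStar N + mu / p * |t| ^ p) R
        (((N:ℝ) - 2) / 2) (((N:ℝ) + 2) / 8) i) (V' i) x) ∧
      ∑ i, V' i (EuclideanSpace.single i 1) = Dv (gc N h u) u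
        (fun t => lam / twoStar N * |t| ^ twoStar N + mu / p * |t| ^ p) R
        (((N:ℝ) - 2) / 2) (((N:ℝ) + 2) / 8) (- mu * (N / p - ((N:ℝ) - 2) / 2)) p x := by
  have hN' : (3:ℝ) ≤ N := by exact_mod_cast hN
  have hN2 : (0:ℝ) < (N:ℝ) - 2 := by linarith
  have hts : 2 < twoStar N := by
    unfold twoStar; rw [lt_div_iff₀ hN2]; linarith
  have hmem := (isOpen_upperHS N h).mem_nhds hx
  have hu' : HasFDerivAt u (fderiv ℝ u x) x :=
    ((hu.smooth2.contDiffAt hmem).differentiableAt (by norm_num)).hasFDerivAt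
  set G : ℝ → ℝ := fun t => lam / twoStar N * |t| ^ twoStar N + mu / p * |t| ^ p with hG
  have hGd : HasDerivAt G (lam * |u x| ^ (twoStar N - 2) * u x + mu * |u x| ^ (p - 2) * u x)
      (u x) := by
    refine (((hasDerivAt_abs_rpow (u x) (by linarith : 1 < twoStar N)).const_mul _).add
      ((hasDerivAt_abs_rpow (u x) (by linarith : 1 < p)).const_mul _)).congr_deriv ?_
    have : twoStar N ≠ 0 := by linarith
    have : p ≠ 0 := by linarith
    field_simp
  have hgi : ∀ i, fderiv ℝ u x (EuclideanSpace.single i 1) = gc N h u i x := fun i =>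
    (gc_eq N h u i x hx).symm
  choose V' hV1 hV2 using fun i => Fld_deriv (gc N h u) u G R (((N:ℝ) - 2) / 2) (((N:ℝ) + 2) / 8)
    x _ _ _ (fun i => hasFDerivAt_gc N h u hu.smooth2 i x hx) hu' hGd hgi i
  refine ⟨V', hV1, ?_⟩
  rw [Finset.sum_congr rfl fun i _ => hV2 i]
  rw [div_alg (fun i => x i) (fun i => gc N h u i x)
    (fun j i => fderiv ℝ (pd u j) x (EuclideanSpace.single i 1))
    (fun i j => pd_symm N h u hu.smooth2 i j x hx)]
  have hpde := hu.pde x hx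
  have hrad : radial u x = ∑ j, x j * gc N h u j x :=
    Finset.sum_congr rfl fun j _ => by rw [gc_eq N h u j x hx]
  rw [hrad] at hpde
  have hlap : lap u x = ∑ j, fderiv ℝ (pd u j) x (EuclideanSpace.single j 1) := rfl
  rw [hlap] at hpde
  unfold Dv
  congr 1
  congr 1
  have hGx : G (u x) = lam / twoStar N * |u x| ^ twoStar N + mu / p * |u x| ^ p := rfl
  rw [hGx, ← abs_rpow_sub_two (u x) _ hts, ← abs_rpow_sub_two (u x) _ hp1]
  generalize ∑ j, fderiv ℝ (pd u j) x (EuclideanSpace.single j 1) = L at *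
  generalize ∑ j, x j * gc N h u j x = ρ at *
  have hL : L = - (1/2 * ρ) - (lam * |u x| ^ (twoStar N - 2) * u x
    + mu * |u x| ^ (p - 2) * u x) := by linarith
  rw [hL]
  have e1 : lam / twoStar N = lam * ((N:ℝ) - 2) / 2 / N := by
    unfold twoStar; field_simp
  rw [e1]
  field_simp
  ring

/-! ### Pointwise bound -/

lemma Dv_le {N : ℕ} (g : Fin N → Euc N → ℝ) (u : Euc N → ℝ) (G : ℝ → ℝ) (R k l c p C : ℝ)
    (hk : 0 ≤ k) (hl : 0 ≤ l) (hc : 0 ≤ c) (hC : 0 ≤ C) (hG : ∀ t, - C * t ^ 2 ≤ G t)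
    (x : Euc N) :
    Dv g u G R k l c p x ≤ - (ct R (∑ j, x j ^ 2) * (N / 4 * u x ^ 2))
      + 4 / R ^ 2 * (2 + 2 * k + 4 * (C + l)) * (Kw x * ((∑ j, g j x ^ 2) + u x ^ 2)) := by
  have hK1 : 1 + (∑ j, x j ^ 2) / 4 ≤ Kw x := by
    unfold Kw
    rw [EuclideanSpace.real_norm_sq_eq]
    have := Real.add_one_le_exp ((∑ j, x j ^ 2) / 4)
    linarith
  have hCS : (∑ j, x j * g j x) ^ 2 ≤ (∑ j, x j ^ 2) * (∑ j, g j x ^ 2) :=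
    Finset.sum_mul_sq_le_sq_mul_sq _ _ _
  have hX : 0 ≤ ∑ j, x j ^ 2 := Finset.sum_nonneg fun j _ => sq_nonneg _
  have hQ : 0 ≤ ∑ j, g j x ^ 2 := Finset.sum_nonneg fun j _ => sq_nonneg _
  unfold Dv
  have ha := ctd_nonpos R (∑ j, x j ^ 2)
  have hb := neg_ctd_le R (∑ j, x j ^ 2) hX
  have hη := ct_nonneg R (∑ j, x j ^ 2)
  have hGu := hG (u x)
  have hup : 0 ≤ |u x| ^ p := by positivity
  generalize |u x| ^ p = up at *
  generalize ct R (∑ j, x j ^ 2) = η at *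
  generalize ctd R (∑ j, x j ^ 2) = a at *
  generalize G (u x) = Gu at *
  generalize Kw x = K at *
  generalize ∑ j, x j ^ 2 = X at *
  generalize ∑ j, g j x ^ 2 = Q at *
  generalize ∑ j, x j * g j x = ρ at *
  generalize u x = v at *
  have hv := sq_nonneg v
  have hXK : X ≤ 4 * K := by linarith
  have hK : 1 ≤ K := by linarith
  have hQK : Q * X ≤ 4 * (K * Q) := by nlinarith
  have hvK : v ^ 2 * X ≤ 4 * (K * v ^ 2) := by nlinarith
  have hvv : v ^ 2 ≤ K * v ^ 2 := by nlinarith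
  have hGX : - C * v ^ 2 * X ≤ Gu * X := mul_le_mul_of_nonneg_right hGu hX
  have hKv : 0 ≤ K * v ^ 2 := by positivity
  have hKQ : 0 ≤ K * Q := by positivity
  have h1 : - (k * v * ρ) ≤ k * (1/2 * (v ^ 2 + ρ ^ 2)) := by
    nlinarith [mul_nonneg hk (sq_nonneg (v + ρ))]
  have h2 : k * (1/2 * (v ^ 2 + ρ ^ 2)) ≤ k * (1/2 * (K * v ^ 2 + 4 * (K * Q))) :=
    mul_le_mul_of_nonneg_left (by linarith) hk
  have h3 : (C + l) * (v ^ 2 * X) ≤ (C + l) * (4 * (K * v ^ 2)) :=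
    mul_le_mul_of_nonneg_left hvK (by linarith)
  have h4 : -(ρ ^ 2 - 1/2 * Q * X + k * v * ρ + Gu * X - l * v ^ 2 * X)
      ≤ (2 + 2 * k + 4 * (C + l)) * (K * (Q + v ^ 2)) := by
    have e5 : 0 ≤ k * (K * v^2) := by positivity
    have e6 : 0 ≤ (C + l) * (K * Q) := by positivity
    nlinarith [sq_nonneg ρ]
  have hM : 0 ≤ (2 + 2 * k + 4 * (C + l)) * (K * (Q + v ^ 2)) := by positivity
  have h5 := mul_le_mul_of_nonneg_left h4 (by linarith : 0 ≤ -a)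
  have h6 := mul_le_mul_of_nonneg_right hb hM
  have h7 : 0 ≤ η * (1/2 * (ρ + N / 2 * v) ^ 2 + c * up) := by positivity
  nlinarith

/-! ### Boundary term -/

/-- embedding of the boundary -/
def iot (m : ℕ) : (Fin (m+1) → ℝ) →L[ℝ] Euc (m+2) :=
  LinearMap.toContinuousLinearMap
    { toFun := fun y => WithLp.toLp 2 (Fin.insertNth (Fin.last (m+1)) (0:ℝ) y)
      map_add' := fun y z => by
        ext i
        refine Fin.lastCases ?_ (fun j => ?_) i
        · simp
        · simp
      map_smul' := fun c y => by
        ext i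
        refine Fin.lastCases ?_ (fun j => ?_) i
        · simp
        · simp }

lemma iot_apply (m : ℕ) (y : Fin (m+1) → ℝ) :
    iot m y = WithLp.toLp 2 (Fin.insertNth (Fin.last (m+1)) (0:ℝ) y) := rfl

lemma iot_last (m : ℕ) (y : Fin (m+1) → ℝ) : iot m y (Fin.last (m+1)) = 0 := by
  simp [iot_apply]

lemma iot_cast (m : ℕ) (y : Fin (m+1) → ℝ) (j : Fin (m+1)) : iot m y j.castSucc = y j := by
  simp [iot_apply]

lemma iot_single (m : ℕ) (j : Fin (m+1)) :
    iot m (Pi.single j 1) = EuclideanSpace.single j.castSucc 1 := by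
  ext i
  refine Fin.lastCases ?_ (fun k => ?_) i
  · rw [iot_last]; simp
  · rw [iot_cast]; simp [Pi.single_apply]

lemma lastIdx_eq (m : ℕ) (h : 0 < m + 2) : lastIdx (m+2) h = Fin.last (m+1) := rfl

lemma iot_mem (m : ℕ) (h : 0 < m + 2) (y : Fin (m+1) → ℝ) : iot m y ∈ upperHSc (m+2) h := by
  simp only [upperHSc, Set.mem_ofPred_eq, lastIdx_eq, iot_last, le_refl]

lemma hasFDerivAt_ct_pi {n : ℕ} (R : ℝ) (x : Fin n → ℝ) :
    ∃ c' : (Fin n → ℝ) →L[ℝ] ℝ, HasFDerivAt (fun x : Fin n → ℝ => ct R (∑ j, x j ^ 2)) c' x ∧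
      ∀ i, c' (Pi.single i 1) = ctd R (∑ j, x j ^ 2) * x i := by
  have h1 : HasFDerivAt (fun x : Fin n → ℝ => ∑ j, x j ^ 2) _ x :=
    HasFDerivAt.fun_sum (u := Finset.univ) fun j _ => (hasFDerivAt_apply (𝕜 := ℝ) j x).pow 2
  refine ⟨_, (hasDerivAt_ct R _).comp_hasFDerivAt x h1, fun i => ?_⟩
  simp [Pi.single_apply]
  ring

lemma ct_face {n : ℕ} (R : ℝ) (hR : 0 < R) (y : Fin n → ℝ) (i : Fin n) (h : y i ^ 2 = R ^ 2) :
    ct R (∑ j, y j ^ 2) = 0 := by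
  refine ct_eq_zero R _ hR ?_
  rw [← h]
  exact Finset.single_le_sum (f := fun j => y j ^ 2) (fun j _ => sq_nonneg _) (Finset.mem_univ i)

lemma bdry_le (m : ℕ) (hm : 1 ≤ m) (h : 0 < m + 2) (lam mu p : ℝ)
    (u : Euc (m+2) → ℝ) (hu : IsClassicalSolution (m+2) h lam mu p u) (G : ℝ → ℝ) (R l : ℝ)
    (hR : 0 < R) :
    ∫ y in Set.Icc (fun _ : Fin (m+1) => -R) (fun _ => R),
      Fld (gc (m+2) h u) u G R ((((m+2:ℕ):ℝ) - 2) / 2) l (Fin.last (m+1)) (iot m y) ≤ 0 := by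
  set q := twoStarL (m+2) with hqdef
  have hm' : (1:ℝ) ≤ m := by exact_mod_cast hm
  have hqe : q * m = 2 * (m + 1) := by
    rw [hqdef]; unfold twoStarL; push_cast
    rw [show (m:ℝ) + 2 - 2 = m by ring, show (m:ℝ) + 2 - 1 = m + 1 by ring]
    field_simp
  have hq2 : 2 < q := by nlinarith
  set v : (Fin (m+1) → ℝ) → ℝ := fun y => u (iot m y) with hv
  set g : Fin (m+1) → (Fin (m+1) → ℝ) → ℝ := fun j y => gc (m+2) h u j.castSucc (iot m y) with hg
  have hvd : ∀ y, ∃ v' : (Fin (m+1) → ℝ) →L[ℝ] ℝ, HasFDerivAt v v' y ∧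
      ∀ j, v' (Pi.single j 1) = g j y := by
    intro y
    have h1 : HasFDerivWithinAt u (fderivWithin ℝ u (upperHSc (m+2) h) (iot m y))
        (upperHSc (m+2) h) (iot m y) :=
      (hu.smooth1.differentiableOn (by norm_num) _ (iot_mem m h y)).hasFDerivWithinAt
    have h2 := h1.comp y (iot m).hasFDerivAt.hasFDerivWithinAt
      (s := Set.univ) (fun z _ => iot_mem m h z)
    refine ⟨_, hasFDerivWithinAt_univ.1 h2, fun j => ?_⟩
    rw [ContinuousLinearMap.comp_apply, iot_single]
    rfl
  have hvc : Continuous v := continuous_iff_continuousAt.2 fun y => by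
    obtain ⟨v', h1, _⟩ := hvd y
    exact h1.continuousAt
  have hgc : ∀ j, Continuous (g j) := fun j =>
    (continuousOn_gc (m+2) h u hu.smooth1 j.castSucc).comp_continuous (iot m).continuous
      (iot_mem m h)
  have hcc := continuous_ct R
  have hcd := continuous_ctd R
  have hp1 : Continuous fun y => |v y| ^ q := hvc.abs.rpow_const fun _ => Or.inr (by linarith)
  have hp2 : Continuous fun y => |v y| ^ (q - 2) :=
    hvc.abs.rpow_const fun _ => Or.inr (by linarith)
  set D : (Fin (m+1) → ℝ) → ℝ := fun y => ctd R (∑ j, y j ^ 2) * ((∑ j, y j ^ 2) * |v y| ^ q)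
    + ct R (∑ j, y j ^ 2) * ((m + 1) * |v y| ^ q
      + q * (|v y| ^ (q - 2) * v y) * ∑ j, y j * g j y) with hD
  have hDc : Continuous D := by
    rw [hD]; fun_prop
  have hint : ∫ y in Set.Icc (fun _ : Fin (m+1) => -R) (fun _ => R), D y = 0 := by
    rw [box_div m (fun _ => -R) (fun _ => R) (fun _ => by simp; linarith)
      (fun j y => ct R (∑ j, y j ^ 2) * (y j * |v y| ^ q)) D ?_ hDc.continuousOn ?_]
    · refine Finset.sum_eq_zero fun i _ => ?_
      have z : ∀ (s : ℝ), s ^ 2 = R ^ 2 → ∀ x : Fin m → ℝ,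
          ct R (∑ j, (Fin.insertNth i s x : Fin (m+1) → ℝ) j ^ 2) = 0 := fun s hs x =>
        ct_face R hR (Fin.insertNth i s x : Fin (m+1) → ℝ) i (by simpa using hs)
      simp [z R rfl, z (-R) (by ring)]
    · intro i
      exact Continuous.continuousOn (by fun_prop)
    · intro y _
      obtain ⟨c', hc, hc'⟩ := hasFDerivAt_ct_pi R y
      obtain ⟨v', hv1, hv2⟩ := hvd y
      have hw : HasFDerivAt (fun y => |v y| ^ q) _ y :=
        (hasDerivAt_abs_rpow (v y) (by linarith : 1 < q)).comp_hasFDerivAt y hv1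
      refine ⟨_, fun j => hc.mul ((hasFDerivAt_apply (𝕜 := ℝ) j y).mul hw), ?_⟩
      simp only [add_apply, smul_apply, hc', hv2, smul_eq_mul, ContinuousLinearMap.proj_apply,
        Pi.single_eq_same, hD]
      generalize ct R (∑ j, y j ^ 2) = η
      generalize ctd R (∑ j, y j ^ 2) = a
      have e : ∀ i, η * (y i * (q * |v y| ^ (q - 2) * v y * g i y) + |v y| ^ q * 1)
          + y i * |v y| ^ q * (a * y i) = η * (q * |v y| ^ (q - 2) * v y) * (y i * g i y)
            + η * |v y| ^ q + (a * |v y| ^ q) * (y i ^ 2) := fun i => by ring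
      rw [Finset.sum_congr rfl fun i _ => e i]
      simp only [Finset.sum_add_distrib, ← Finset.mul_sum]
      simp only [Finset.sum_const, Finset.card_univ, Fintype.card_fin, nsmul_eq_mul]
      push_cast
      ring
  have hlast : ∀ y, gc (m+2) h u (Fin.last (m+1)) (iot m y)
      = - (Real.sqrt lam * |v y| ^ (q - 2) * v y) := by
    intro y
    have := hu.bc (iot m y) (by simp only [bdryHS, Set.mem_ofPred_eq, lastIdx_eq, iot_last])
    have e : gc (m+2) h u (Fin.last (m+1)) (iot m y) = pdN (m+2) h u (iot m y) := rfl
    rw [e]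
    linarith
  have hF : ∀ y, Fld (gc (m+2) h u) u G R ((((m+2:ℕ):ℝ) - 2) / 2) l (Fin.last (m+1)) (iot m y)
      = - (Real.sqrt lam / q) * D y
        + (Real.sqrt lam / q) * (ctd R (∑ j, y j ^ 2) * ((∑ j, y j ^ 2) * |v y| ^ q)) := by
    intro y
    have hq0 : q ≠ 0 := by linarith
    unfold Fld
    simp only [hlast]
    have e1 : ∑ j, iot m y j ^ 2 = ∑ j, y j ^ 2 := by
      rw [Fin.sum_univ_castSucc]; simp [iot_last, iot_cast]
    have e2 : ∑ j, iot m y j * gc (m+2) h u j (iot m y) = ∑ j, y j * g j y := by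
      rw [Fin.sum_univ_castSucc]; simp [iot_last, iot_cast, hg]
    rw [e1, e2, iot_last]
    simp only [hD]
    have e3 : u (iot m y) = v y := rfl
    rw [e3, ← abs_rpow_sub_two (v y) q hq2]
    have hm1 : ((m:ℝ) + 1) = q * m / 2 := by linarith
    rw [hm1]
    push_cast
    field_simp
    ring
  have hs : 0 ≤ Real.sqrt lam / q := div_nonneg (Real.sqrt_nonneg _) (by linarith)
  calc _ ≤ ∫ y in Set.Icc (fun _ : Fin (m+1) => -R) (fun _ => R), - (Real.sqrt lam / q) * D y := by
        refine setIntegral_mono_on ?_ ?_ measurableSet_Icc ?_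
        · refine ContinuousOn.integrableOn_compact isCompact_Icc (Continuous.continuousOn ?_)
          rw [funext hF]; fun_prop
        · exact (Continuous.continuousOn (by fun_prop)).integrableOn_compact isCompact_Icc
        · intro y _
          rw [hF]
          have : 0 ≤ (∑ j, y j ^ 2) * |v y| ^ q := by positivity
          have := mul_nonpos_of_nonpos_of_nonneg (ctd_nonpos R (∑ j, y j ^ 2)) this
          have := mul_nonpos_of_nonneg_of_nonpos hs this
          linarith
    _ = 0 := by rw [integral_const_mul, hint, mul_zero]

/-! ### Integration over a half box -/

/-- lower corner of the half box -/
def lowc (m : ℕ) (R : ℝ) : Fin (m+2) → ℝ := Fin.insertNth (Fin.last (m+1)) (0:ℝ) (fun _ => -R)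

lemma lowc_last (m : ℕ) (R : ℝ) : lowc m R (Fin.last (m+1)) = 0 := by simp [lowc]
lemma lowc_cast (m : ℕ) (R : ℝ) (j : Fin (m+1)) : lowc m R j.castSucc = -R := by simp [lowc]

lemma continuous_toLp2 (n : ℕ) : Continuous (fun y : Fin n → ℝ => (WithLp.toLp 2 y : Euc n)) :=
  PiLp.continuous_toLp 2 _

lemma toLp_mem (m : ℕ) (h : 0 < m + 2) (R : ℝ) (y : Fin (m+2) → ℝ)
    (hy : y ∈ Set.Icc (lowc m R) (fun _ => R)) :
    (WithLp.toLp 2 y : Euc (m+2)) ∈ upperHSc (m+2) h := by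
  have := hy.1 (Fin.last (m+1))
  rw [lowc_last] at this
  simpa only [upperHSc, Set.mem_ofPred_eq, lastIdx_eq] using this

lemma contOn_aux1 {α : Type*} [TopologicalSpace α] (s : Set α) (a X r Q v w η z : α → ℝ)
    (k l c d e : ℝ) (h1 : ContinuousOn a s) (h2 : ContinuousOn X s) (h3 : ContinuousOn r s)
    (h4 : ContinuousOn Q s) (h5 : ContinuousOn v s) (h6 : ContinuousOn w s)
    (h7 : ContinuousOn η s) (h8 : ContinuousOn z s) :
    ContinuousOn (fun y => a y * (r y ^ 2 - 1/2 * Q y * X y + k * v y * r y + w y * X y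
      - l * v y ^ 2 * X y) + η y * (- 1/2 * (r y + d * v y) ^ 2 - e * v y ^ 2 - c * z y)) s := by
  fun_prop

lemma contOn_aux2 {α : Type*} [TopologicalSpace α] (s : Set α) (X r Q v w η z : α → ℝ)
    (k l : ℝ) (h2 : ContinuousOn X s) (h3 : ContinuousOn r s)
    (h4 : ContinuousOn Q s) (h5 : ContinuousOn v s) (h6 : ContinuousOn w s)
    (h7 : ContinuousOn η s) (h8 : ContinuousOn z s) :
    ContinuousOn (fun y => η y * (r y * z y - 1/2 * Q y * X y + k * (v y * z y) + w y * X y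
      - l * v y ^ 2 * X y)) s := by
  fun_prop

lemma box_ineq (m : ℕ) (hm : 1 ≤ m) (h : 0 < m + 2) (lam mu p : ℝ) (hp1 : 2 < p)
    (hp2 : p < twoStar (m+2))
    (u : Euc (m+2) → ℝ) (hu : IsClassicalSolution (m+2) h lam mu p u) (R : ℝ) (hR : 0 < R) :
    ContinuousOn (fun y : Fin (m+2) → ℝ => Dv (gc (m+2) h u) u
        (fun t => lam / twoStar (m+2) * |t| ^ twoStar (m+2) + mu / p * |t| ^ p) R
        ((((m+2:ℕ):ℝ) - 2) / 2) ((((m+2:ℕ):ℝ) + 2) / 8)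
        (- mu * (((m+2:ℕ):ℝ) / p - (((m+2:ℕ):ℝ) - 2) / 2)) p (WithLp.toLp 2 y))
        (Set.Icc (lowc m R) (fun _ => R)) ∧
    0 ≤ ∫ y in Set.Icc (lowc m R) (fun _ => R), Dv (gc (m+2) h u) u
        (fun t => lam / twoStar (m+2) * |t| ^ twoStar (m+2) + mu / p * |t| ^ p) R
        ((((m+2:ℕ):ℝ) - 2) / 2) ((((m+2:ℕ):ℝ) + 2) / 8)
        (- mu * (((m+2:ℕ):ℝ) / p - (((m+2:ℕ):ℝ) - 2) / 2)) p (WithLp.toLp 2 y) := by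
  set G : ℝ → ℝ := fun t => lam / twoStar (m+2) * |t| ^ twoStar (m+2) + mu / p * |t| ^ p with hG
  have hGc : Continuous G := by
    have h1 : Continuous fun t : ℝ => |t| ^ twoStar (m+2) :=
      continuous_abs.rpow_const fun _ => Or.inr (by linarith)
    have h2 : Continuous fun t : ℝ => |t| ^ p :=
      continuous_abs.rpow_const fun _ => Or.inr (by linarith)
    rw [hG]; fun_prop
  have hmaps : Set.MapsTo (fun y : Fin (m+2) → ℝ => (WithLp.toLp 2 y : Euc (m+2)))
      (Set.Icc (lowc m R) (fun _ => R)) (upperHSc (m+2) h) := fun y hy => toLp_mem m h R y hy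
  have huc : ContinuousOn (fun y : Fin (m+2) → ℝ => u (WithLp.toLp 2 y))
      (Set.Icc (lowc m R) (fun _ => R)) :=
    hu.smooth1.continuousOn.comp (continuous_toLp2 _).continuousOn hmaps
  have hgc : ∀ j, ContinuousOn (fun y : Fin (m+2) → ℝ => gc (m+2) h u j (WithLp.toLp 2 y))
      (Set.Icc (lowc m R) (fun _ => R)) := fun j =>
    (continuousOn_gc (m+2) h u hu.smooth1 j).comp (continuous_toLp2 _).continuousOn hmaps
  have hGu : ContinuousOn (fun y : Fin (m+2) → ℝ => G (u (WithLp.toLp 2 y)))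
      (Set.Icc (lowc m R) (fun _ => R)) := hGc.comp_continuousOn huc
  have hup : ContinuousOn (fun y : Fin (m+2) → ℝ => |u (WithLp.toLp 2 y)| ^ p)
      (Set.Icc (lowc m R) (fun _ => R)) :=
    huc.abs.rpow_const fun _ _ => Or.inr (by linarith)
  have hct : ContinuousOn (fun y : Fin (m+2) → ℝ => ct R (∑ j, y j ^ 2))
      (Set.Icc (lowc m R) (fun _ => R)) :=
    ((continuous_ct R).comp (by fun_prop)).continuousOn
  have hctd : ContinuousOn (fun y : Fin (m+2) → ℝ => ctd R (∑ j, y j ^ 2))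
      (Set.Icc (lowc m R) (fun _ => R)) :=
    ((continuous_ctd R).comp (by fun_prop)).continuousOn
  have hXs : ContinuousOn (fun y : Fin (m+2) → ℝ => ∑ j, y j ^ 2)
      (Set.Icc (lowc m R) (fun _ => R)) := Continuous.continuousOn (by fun_prop)
  have hρ : ContinuousOn (fun y : Fin (m+2) → ℝ => ∑ j, y j * gc (m+2) h u j (WithLp.toLp 2 y))
      (Set.Icc (lowc m R) (fun _ => R)) :=
    continuousOn_finsetSum _ fun j _ => (continuous_apply j).continuousOn.mul (hgc j)
  have hQ : ContinuousOn (fun y : Fin (m+2) → ℝ => ∑ j, gc (m+2) h u j (WithLp.toLp 2 y) ^ 2)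
      (Set.Icc (lowc m R) (fun _ => R)) :=
    continuousOn_finsetSum _ fun j _ => (hgc j).pow 2
  have hDc : ContinuousOn (fun y : Fin (m+2) → ℝ => Dv (gc (m+2) h u) u G R
        ((((m+2:ℕ):ℝ) - 2) / 2) ((((m+2:ℕ):ℝ) + 2) / 8)
        (- mu * (((m+2:ℕ):ℝ) / p - (((m+2:ℕ):ℝ) - 2) / 2)) p (WithLp.toLp 2 y))
        (Set.Icc (lowc m R) (fun _ => R)) := by
    exact contOn_aux1 _ _ _ _ _ _ _ _ _ _ _ _ _ _ hctd hXs hρ hQ huc hGu hct hup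
  refine ⟨hDc, ?_⟩
  have hle : lowc m R ≤ fun _ => R := by
    intro i
    refine Fin.lastCases ?_ (fun j => ?_) i
    · rw [lowc_last]; exact hR.le
    · rw [lowc_cast]; linarith
  rw [box_div (m+1) (lowc m R) (fun _ => R) hle
    (fun i y => Fld (gc (m+2) h u) u G R ((((m+2:ℕ):ℝ) - 2) / 2) ((((m+2:ℕ):ℝ) + 2) / 8) i
      (WithLp.toLp 2 y)) _ ?_ hDc ?_]
  · have z : ∀ (i : Fin (m+2)) (s : ℝ), s ^ 2 = R ^ 2 → ∀ x : Fin (m+1) → ℝ,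
          Fld (gc (m+2) h u) u G R ((((m+2:ℕ):ℝ) - 2) / 2) ((((m+2:ℕ):ℝ) + 2) / 8) i
          (WithLp.toLp 2 (Fin.insertNth i s x : Fin (m+2) → ℝ)) = 0 := fun i s hs x => by
      unfold Fld
      have := ct_face R hR (Fin.insertNth i s x : Fin (m+2) → ℝ) i (by simpa using hs)
      rw [this, zero_mul]
    rw [Fin.sum_univ_castSucc]
    have hz : ∀ i : Fin (m+1), lowc m R i.castSucc ^ 2 = R ^ 2 := fun i => by
      rw [lowc_cast]; ring
    rw [Finset.sum_eq_zero, zero_add]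
    · simp only [z _ R rfl, integral_zero, zero_sub, Left.nonneg_neg_iff]
      have e : lowc m R ∘ (Fin.last (m+1)).succAbove = fun _ => -R := by
        funext j
        simp only [Function.comp, Fin.succAbove_last, lowc_cast]
      rw [e, lowc_last]
      exact bdry_le m hm h lam mu p u hu G R _ hR
    · intro i _
      simp only [z _ R rfl, z _ _ (hz i), integral_zero, sub_self]
  · intro i
    exact contOn_aux2 _ _ _ _ _ _ _ _ _ _ (continuous_apply i).continuousOn hρ hQ huc hGu hct
      (hgc i)
  · intro y hy
    have hmem : (WithLp.toLp 2 y : Euc (m+2)) ∈ upperHS (m+2) h := by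
      have := (hy (Fin.last (m+1))).1
      rw [lowc_last] at this
      simpa only [upperHS, Set.mem_ofPred_eq, lastIdx_eq] using this
    obtain ⟨V', hV1, hV2⟩ := interior_div (m+2) (by omega) h lam mu p hp1 u hu R _ hmem
    refine ⟨fun i => (V' i).comp
      ((EuclideanSpace.equiv (Fin (m+2)) ℝ).symm : (Fin (m+2) → ℝ) →L[ℝ] Euc (m+2)), ?_, ?_⟩
    · intro i
      exact HasFDerivAt.comp y (hV1 i)
        ((EuclideanSpace.equiv (Fin (m+2)) ℝ).symm :
          (Fin (m+2) → ℝ) →L[ℝ] Euc (m+2)).hasFDerivAt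
    · rw [← hV2]
      rfl

lemma energy_ineq (m : ℕ) (hm : 1 ≤ m) (h : 0 < m + 2) (lam mu p : ℝ) (hlam : 0 < lam)
    (hmu : mu ≤ 0) (hp1 : 2 < p) (hp2 : p < twoStar (m+2))
    (u : Euc (m+2) → ℝ) (hu : IsClassicalSolution (m+2) h lam mu p u)
    (hX : FiniteEnergy (m+2) h u) :
    ∃ M : ℝ, ∀ R : ℝ, 0 < R →
      IntegrableOn (fun y : Fin (m+2) → ℝ =>
        ct R (∑ j, y j ^ 2) * ((((m+2:ℕ):ℝ)) / 4 * u (WithLp.toLp 2 y) ^ 2))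
        (Set.Icc (lowc m R) (fun _ => R)) ∧
      ∫ y in Set.Icc (lowc m R) (fun _ => R),
        ct R (∑ j, y j ^ 2) * ((((m+2:ℕ):ℝ)) / 4 * u (WithLp.toLp 2 y) ^ 2) ≤ M / R ^ 2 := by
  obtain ⟨C, hC0, hC⟩ := young_lower lam mu p (twoStar (m+2)) hlam hmu hp1 hp2
  set G : ℝ → ℝ := fun t => lam / twoStar (m+2) * |t| ^ twoStar (m+2) + mu / p * |t| ^ p with hG
  have hm' : (1:ℝ) ≤ m := by exact_mod_cast hm
  set k : ℝ := (((m+2:ℕ):ℝ) - 2) / 2 with hk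
  set l : ℝ := (((m+2:ℕ):ℝ) + 2) / 8 with hl
  set c : ℝ := - mu * (((m+2:ℕ):ℝ) / p - (((m+2:ℕ):ℝ) - 2) / 2) with hc
  have hk0 : 0 ≤ k := by rw [hk]; push_cast; linarith
  have hl0 : 0 ≤ l := by rw [hl]; positivity
  have hc0 : 0 ≤ c := by
    rw [hc]
    refine mul_nonneg (by linarith) ?_
    have : (((m+2:ℕ):ℝ) - 2) / 2 * p ≤ ((m+2:ℕ):ℝ) := by
      have h1 : p * (((m+2:ℕ):ℝ) - 2) < 2 * ((m+2:ℕ):ℝ) := by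
        have := hp2
        unfold twoStar at this
        rwa [lt_div_iff₀ (by push_cast; linarith)] at this
      linarith
    rw [sub_nonneg, le_div_iff₀ (by linarith)]
    exact this
  set A : ℝ := 2 + 2 * k + 4 * (C + l) with hA
  have hA0 : 0 ≤ A := by positivity
  -- transfer of the energy integral
  set W : Euc (m+2) → ℝ := fun x => Kw x * (gradSq u x + (u x) ^ 2) with hW
  have hW0 : ∀ x, 0 ≤ W x := fun x => by
    rw [hW]; unfold Kw gradSq; positivity
  have hmp := PiLp.volume_preserving_toLp (Fin (m+2))
  have hme : MeasurableEmbedding (fun y : Fin (m+2) → ℝ => (WithLp.toLp 2 y : Euc (m+2))) :=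
    (MeasurableEquiv.toLp 2 (Fin (m+2) → ℝ)).measurableEmbedding
  set S : Set (Fin (m+2) → ℝ) := (fun y => (WithLp.toLp 2 y : Euc (m+2))) ⁻¹' upperHS (m+2) h
    with hS
  have hWi : IntegrableOn (fun y : Fin (m+2) → ℝ => W (WithLp.toLp 2 y)) S :=
    (hmp.integrableOn_comp_preimage hme).2 hX
  refine ⟨4 * A * ∫ y in S, W (WithLp.toLp 2 y), fun R hR => ?_⟩
  obtain ⟨hDc, hD0⟩ := box_ineq m hm h lam mu p hp1 hp2 u hu R hR
  have hDi := hDc.integrableOn_compact (μ := volume) isCompact_Icc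
  have hmaps : Set.MapsTo (fun y : Fin (m+2) → ℝ => (WithLp.toLp 2 y : Euc (m+2)))
      (Set.Icc (lowc m R) (fun _ => R)) (upperHSc (m+2) h) := fun y hy => toLp_mem m h R y hy
  have huc : ContinuousOn (fun y : Fin (m+2) → ℝ => u (WithLp.toLp 2 y))
      (Set.Icc (lowc m R) (fun _ => R)) :=
    hu.smooth1.continuousOn.comp (continuous_toLp2 _).continuousOn hmaps
  have hct : ContinuousOn (fun y : Fin (m+2) → ℝ => ct R (∑ j, y j ^ 2))
      (Set.Icc (lowc m R) (fun _ => R)) :=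
    ((continuous_ct R).comp (by fun_prop)).continuousOn
  have hfi : IntegrableOn (fun y : Fin (m+2) → ℝ =>
        ct R (∑ j, y j ^ 2) * ((((m+2:ℕ):ℝ)) / 4 * u (WithLp.toLp 2 y) ^ 2))
        (Set.Icc (lowc m R) (fun _ => R)) :=
    ContinuousOn.integrableOn_compact isCompact_Icc (hct.mul (continuousOn_const.mul (huc.pow 2)))
  refine ⟨hfi, ?_⟩
  set P : Set (Fin (m+2) → ℝ) := Set.pi Set.univ fun i => Set.Ioo (lowc m R i) R with hP
  have hae : P =ᵐ[volume] Set.Icc (lowc m R) (fun _ => R) := Measure.univ_pi_Ioo_ae_eq_Icc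
  have hPm : MeasurableSet P := MeasurableSet.univ_pi fun i => measurableSet_Ioo
  have hPS : P ⊆ S := by
    intro y hy
    have := (hy (Fin.last (m+1)) (Set.mem_univ _)).1
    rw [lowc_last] at this
    simpa only [hS, Set.mem_preimage, upperHS, Set.mem_ofPred_eq, lastIdx_eq] using this
  rw [← setIntegral_congr_set hae] at hD0 ⊢
  rw [← integrableOn_congr_set_ae hae] at hfi hDi
  have hWP : IntegrableOn (fun y : Fin (m+2) → ℝ => W (WithLp.toLp 2 y)) P := hWi.mono_set hPS
  have hWcP := hWP.const_mul (4 / R ^ 2 * A)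
  have step := setIntegral_mono_on hDi (hWcP.sub hfi) hPm (fun y hy => ?_)
  · rw [integral_sub' hWcP hfi, integral_const_mul] at step
    have hmono : ∫ y in P, W (WithLp.toLp 2 y) ≤ ∫ y in S, W (WithLp.toLp 2 y) :=
      setIntegral_mono_set hWi (Eventually.of_forall fun y => hW0 _) hPS.eventuallyLE
    have := mul_le_mul_of_nonneg_left hmono (by positivity : 0 ≤ 4 / R ^ 2 * A)
    have e : 4 * A * (∫ y in S, W (WithLp.toLp 2 y)) / R ^ 2
      = 4 / R ^ 2 * A * ∫ y in S, W (WithLp.toLp 2 y) := by ring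
    rw [e]
    linarith
  · have hb := Dv_le (gc (m+2) h u) u G R k l c p C hk0 hl0 hc0 hC0 hC (WithLp.toLp 2 y)
    have hg : ∑ j, gc (m+2) h u j (WithLp.toLp 2 y) ^ 2 = gradSq u (WithLp.toLp 2 y) :=
      Finset.sum_congr rfl fun j _ => by rw [gc_eq (m+2) h u j _ (hPS hy)]
    rw [hg] at hb
    refine hb.trans (le_of_eq ?_)
    simp only [Pi.sub_apply, hW]
    ring

/-- Theorem 1.0, nonexistence: if `N ≥ 3`, `λ > 0`, `μ ≤ 0` and `2 < p < 2*`,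
then any finite-energy classical solution of problem (1.1) vanishes identically on `ℝ^N_+`. -/
theorem statement0 (N : ℕ) (hN : 3 ≤ N) (lam mu p : ℝ)
    (hlam : 0 < lam) (hmu : mu ≤ 0) (hp1 : 2 < p) (hp2 : p < twoStar N)
    (u : Euc N → ℝ)
    (hu : IsClassicalSolution N (by omega) lam mu p u)
    (hX : FiniteEnergy N (by omega) u) :
    ∀ x ∈ upperHS N (by omega : 0 < N), u x = 0 := by
  obtain ⟨m, rfl⟩ : ∃ m, N = m + 2 := ⟨N - 2, by omega⟩
  have hm : 1 ≤ m := by omega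
  have h : 0 < m + 2 := by omega
  intro x0 hx0
  by_contra hne
  obtain ⟨M, hM⟩ := energy_ineq m hm h lam mu p hlam hmu hp1 hp2 u hu hX
  set y0 : Fin (m+2) → ℝ := WithLp.ofLp x0 with hy0
  set δ := u x0 ^ 2 / 2 with hδ
  have hδ0 : 0 < δ := by positivity
  have hmem := (isOpen_upperHS (m+2) h).mem_nhds hx0
  have hcont : ContinuousAt u x0 :=
    (hu.smooth2.contDiffAt hmem).continuousAt
  have hev : ∀ᶠ x in 𝓝 x0, x ∈ upperHS (m+2) h ∧ δ < u x ^ 2 := by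
    refine (eventually_mem_set.2 hmem).and ?_
    refine (hcont.pow 2).eventually (lt_mem_nhds ?_)
    rw [hδ]; simp only [Pi.pow_apply] at *
    linarith
  have hev2 : ∀ᶠ y in 𝓝 y0, (WithLp.toLp 2 y : Euc (m+2)) ∈ upperHS (m+2) h ∧
      δ < u (WithLp.toLp 2 y) ^ 2 :=
    ((continuous_toLp2 (m+2)).tendsto y0).eventually hev
  obtain ⟨r, hr, hball⟩ := Metric.eventually_nhds_iff_ball.1 hev2
  set B := ‖y0‖ + r with hB
  have hB0 : 0 < B := by positivity
  have hcoord : ∀ y ∈ Metric.ball y0 r, ∀ i, |y i| ≤ B := by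
    intro y hy i
    have h1 : ‖y‖ ≤ B := by
      have := norm_sub_norm_le y y0
      have := mem_ball_iff_norm.1 hy
      linarith
    exact (norm_le_pi_norm y i).trans h1
  set vol := volume.real (Metric.ball y0 r) with hvol
  have hvol0 : 0 < vol := by
    rw [hvol, measureReal_def]
    exact ENNReal.toReal_pos (Metric.measure_ball_pos volume y0 hr).ne' measure_ball_lt_top.ne
  have key : ∀ R : ℝ, B ≤ R → 2 * ((m + 2) * B ^ 2) ≤ R ^ 2 →
      1 / 4 * (((m+2:ℕ):ℝ) / 4 * δ) * vol ≤ M / R ^ 2 := by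
    intro R hBR hR2
    have hR : 0 < R := by linarith
    obtain ⟨hi, hle⟩ := hM R hR
    refine le_trans ?_ hle
    have hsub : Metric.ball y0 r ⊆ Set.Icc (lowc m R) (fun _ => R) := by
      intro y hy
      have hc := hcoord y hy
      refine ⟨fun i => ?_, fun i => ((abs_le.1 (hc i)).2).trans hBR⟩
      refine Fin.lastCases ?_ (fun j => ?_) i
      · rw [lowc_last]
        have := (hball y hy).1
        simp only [upperHS, Set.mem_ofPred_eq, lastIdx_eq] at this
        exact this.le
      · rw [lowc_cast]
        have := (abs_le.1 (hc j.castSucc)).1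
        linarith
    have hn : ∀ y : Fin (m+2) → ℝ,
        0 ≤ ct R (∑ j, y j ^ 2) * ((((m+2:ℕ):ℝ)) / 4 * u (WithLp.toLp 2 y) ^ 2) := fun y =>
      mul_nonneg (ct_nonneg _ _) (by positivity)
    refine le_trans ?_ (setIntegral_mono_set hi (Eventually.of_forall hn) hsub.eventuallyLE)
    have hconst : ∫ _ in Metric.ball y0 r, 1 / 4 * (((m+2:ℕ):ℝ) / 4 * δ)
        = 1 / 4 * (((m+2:ℕ):ℝ) / 4 * δ) * vol := by
      rw [setIntegral_const, smul_eq_mul, mul_comm]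
    rw [← hconst]
    refine setIntegral_mono_on (integrableOn_const measure_ball_lt_top.ne) (hi.mono_set hsub)
      measurableSet_ball fun y hy => ?_
    have hs : ∑ j, y j ^ 2 ≤ (m + 2) * B ^ 2 := by
      calc ∑ j, y j ^ 2 ≤ ∑ j : Fin (m+2), B ^ 2 :=
            Finset.sum_le_sum fun j _ => sq_le_sq' (abs_le.1 (hcoord y hy j)).1
              (abs_le.1 (hcoord y hy j)).2
        _ = (m + 2) * B ^ 2 := by simp
    have h1 := ct_ge R (∑ j, y j ^ 2) hR (by linarith)
    have h2 := (hball y hy).2.le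
    refine mul_le_mul h1 (mul_le_mul_of_nonneg_left h2 (by positivity)) (by positivity) ?_
    exact ct_nonneg _ _
  have htend : Tendsto (fun R : ℝ => M / R ^ 2) atTop (𝓝 0) :=
    Tendsto.div_atTop tendsto_const_nhds (tendsto_pow_atTop (by norm_num))
  have hpos : 0 < 1 / 4 * (((m+2:ℕ):ℝ) / 4 * δ) * vol := by positivity
  have hbig : ∀ᶠ R : ℝ in atTop, 2 * ((m + 2) * B ^ 2) ≤ R ^ 2 :=
    (tendsto_pow_atTop (α := ℝ) (by norm_num : (2:ℕ) ≠ 0)).eventually_ge_atTop _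
  obtain ⟨R, ⟨h1, h2⟩, h3⟩ := (((htend.eventually (gt_mem_nhds hpos)).and
    (eventually_ge_atTop B)).and hbig).exists
  exact absurd (key R h2 h3) (not_le.2 h1)
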